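/- Let $C_{coer}, \varepsilon, \omega, C_I, C_P, H, \Delta t$ be positive real numbers and $\Phi \ge 0$. Define $\lambda_0 := \dfrac{\omega C_{coer}\varepsilon^2 - 2\omega^2 C_I^2 C_P^2 H^2 - 4}{C_{coer}\varepsilon^2 + 4\Delta t}$ and assume $\lambda_0 > 0$. Suppose $(x_m)_{m \ge 0}$ is a sequence of nonnegative real numbers satisfying, for every $m \ge 1$, $$\left[1 + \omega\,\Delta t - \frac{2\omega^2 C_I^2 C_P^2 H^2\,\Delta t}{C_{coer}\varepsilon^2}\right] x_m \le \left[1 + \frac{4\Delta t}{C_{coer}\varepsilon^2}\right] x_{m-1} + \omega C_I^2\,\Delta t\,\Phi.$$ Then for every $m \ge 0$, $$x_m \le x_0\left(\frac{1}{1 + \lambda_0\,\Delta t}\right)^{m} + \frac{\omega\, C_I^2\, C_{coer}\,\varepsilon^2\,\Phi}{\omega C_{coer}\varepsilon^2 - 2\omega^2 C_I^2 C_P^2 H^2 - 4};$$ in particular the sequence is uniformly bounded: $x_m \le x_0 + \dfrac{\omega\, C_I^2\, C_{coer}\,\varepsilon^2\,\Phi}{\omega C_{coer}\varepsilon^2 -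 2\omega^2 C_I^2 C_P^2 H^2 - 4}$ for all $m$. -/

import Mathlib

theorem long_time_stability_core
    (Ccoer ε ω CI CP H Δt : ℝ) (Φ : ℝ)
    (hCcoer : 0 < Ccoer) (hε : 0 < ε) (hω : 0 < ω) (hCI : 0 < CI)
    (hCP : 0 < CP) (hH : 0 < H) (hΔt : 0 < Δt) (hΦ : 0 ≤ Φ)
    (lam0 : ℝ)
    (hlam0 : lam0 = (ω * Ccoer * ε ^ 2 - 2 * ω ^ 2 * CI ^ 2 * CP ^ 2 * H ^ 2 - 4)
      / (Ccoer * ε ^ 2 + 4 * Δt))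
    (hlam0pos : 0 < lam0)
    (x : ℕ → ℝ) (hx : ∀ m : ℕ, 0 ≤ x m)
    (hrec : ∀ m : ℕ, 1 ≤ m →
      (1 + ω * Δt - 2 * ω ^ 2 * CI ^ 2 * CP ^ 2 * H ^ 2 * Δt / (Ccoer * ε ^ 2)) * x m
        ≤ (1 + 4 * Δt / (Ccoer * ε ^ 2)) * x (m - 1) + ω * CI ^ 2 * Δt * Φ) :
    ∀ m : ℕ,
      x m ≤ x 0 * (1 / (1 + lam0 * Δt)) ^ m
          + ω * CI ^ 2 * Ccoer * ε ^ 2 * Φ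
            / (ω * Ccoer * ε ^ 2 - 2 * ω ^ 2 * CI ^ 2 * CP ^ 2 * H ^ 2 - 4)
      ∧ x m ≤ x 0
          + ω * CI ^ 2 * Ccoer * ε ^ 2 * Φ
            / (ω * Ccoer * ε ^ 2 - 2 * ω ^ 2 * CI ^ 2 * CP ^ 2 * H ^ 2 - 4) := by
  have hK : 0 < Ccoer * ε ^ 2 := by positivity
  have hS : 0 < Ccoer * ε ^ 2 + 4 * Δt := by positivity
  set D := ω * Ccoer * ε ^ 2 - 2 * ω ^ 2 * CI ^ 2 * CP ^ 2 * H ^ 2 - 4 with hDdef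
  have hDS : D = lam0 * (Ccoer * ε ^ 2 + 4 * Δt) := by
    rw [hlam0]; field_simp
  have hD : 0 < D := by rw [hDS]; positivity
  set B := ω * CI ^ 2 * Ccoer * ε ^ 2 * Φ / D with hBdef
  have hBD : D * B = ω * CI ^ 2 * Ccoer * ε ^ 2 * Φ := by
    rw [hBdef]; field_simp
  have hL : 0 < 1 + lam0 * Δt := by positivity
  have step : ∀ m, (1 + lam0 * Δt) * x (m + 1) ≤ x m + lam0 * Δt * B := by
    intro m
    have h := hrec (m + 1) (by omega)
    rw [Nat.add_sub_cancel] at h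
    have h2 := mul_le_mul_of_nonneg_left h hK.le
    have e1 : Ccoer * ε ^ 2 * ((1 + ω * Δt - 2 * ω ^ 2 * CI ^ 2 * CP ^ 2 * H ^ 2 * Δt
        / (Ccoer * ε ^ 2)) * x (m + 1))
        = (Ccoer * ε ^ 2 + 4 * Δt + D * Δt) * x (m + 1) := by
      rw [hDdef]; field_simp; ring
    have e2 : Ccoer * ε ^ 2 * ((1 + 4 * Δt / (Ccoer * ε ^ 2)) * x m + ω * CI ^ 2 * Δt * Φ)
        = (Ccoer * ε ^ 2 + 4 * Δt) * x m + Δt * (D * B) := by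
      rw [hBD]; field_simp
    rw [e1, e2, hDS] at h2
    refine le_of_mul_le_mul_left ?_ hS
    linarith
  have main : ∀ m, x m ≤ x 0 * (1 / (1 + lam0 * Δt)) ^ m + B := by
    intro m
    induction m with
    | zero =>
      have : 0 ≤ B := by rw [hBdef]; positivity
      simpa using this
    | succ m ih =>
      refine le_of_mul_le_mul_left ?_ hL
      have e : (1 + lam0 * Δt) * (x 0 * (1 / (1 + lam0 * Δt)) ^ (m + 1) + B)
          = x 0 * (1 / (1 + lam0 * Δt)) ^ m + (1 + lam0 * Δt) * B := by
        rw [pow_succ]; field_simp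
      rw [e]
      linarith [step m]
  intro m
  refine ⟨main m, (main m).trans ?_⟩
  have hr : (1 / (1 + lam0 * Δt)) ^ m ≤ 1 := by
    apply pow_le_one₀ (by positivity)
    rw [div_le_one hL]
    have : 0 < lam0 * Δt := by positivity
    linarith
  have := mul_le_mul_of_nonneg_left hr (hx 0)
  linarith
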